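/- Generalized entanglement swapping (any graph state is mergeable): let n = h + m, let G = Matrix.fromBlocks G_H Γᵀ Γ G_M be as in the context, and fix a decomposition Γ = V * (Matrix.fromBlocks 1 R 0 0) * U with U : Matrix (Fin h) (Fin h) (ZMod 2) invertible, V : Matrix (Fin m) (Fin m) (ZMod 2) invertible, r ≤ h, r ≤ m, and R : Matrix (Fin r) (Fin (h − r)) (ZMod 2) (blocks along finSumFinEquiv). Start from two copies of the graph state, Ψ₀(s, t, s', t') := |G⟩(s ⧺ t) · |G⟩(s' ⧺ t'), on registers s, s' : Fin h → ZMod 2 and t, t' : Fin m → ZMod 2. Fix arbitrary outcomes b c : Fin r → ZMod 2, a : Fin (m − r) → ZMod 2, d : Fin (h − r) → ZMod 2, and apply to Ψ₀ the following operations, acting only on registers t and s': (i) multiply the amplitude by (−1)^{Q_{G_M}(t)} and by (−1)^{Q_{G_H}(s')}; (ii) apply a Hadamard to every qubit of register t, i.e. in that register ψ ↦ (fun t ↦ 2^(−m/2) · ∑_u (−1)^{⟨t,u⟩} ψ(u)); (iii) relabel register t by the unitary |u⟩ ↦ |V⁻¹ ·ᵥ u⟩ and register s' by the unitary |u⟩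 ↦ |U ·ᵥ u⟩; (iv) for each i < r, contract the pair of qubits (t_i, s'_i) with the Bell functional sending the basis pair (0, c i) to 1, the basis pair (1, c i + 1) to (−1)^{b i}, and the other two basis pairs to 0; (v) for each coordinate i of t with r ≤ i < m, contract qubit t_i with the functional u ↦ (−1)^{a_i · u} (unnormalized projection onto the Hadamard-basis state with outcome a_i); (vi) for each coordinate i of s' with r ≤ i < h, contract qubit s'_i with the functional u ↦ (if u = d_i then 1 else 0). Let Ψ₁ : (Fin h → ZMod 2) × (Fin m → ZMod 2) → ℂ be the resulting vector on the surviving registers (s, t'). Finally set x := U⁻¹ ·ᵥ w, where w : Fin h → ZMod 2 has first r coordinates c + R ·ᵥ d and last h − r coordinates 0, set z := Uᵀ ·ᵥ w' + G_H ·ᵥ x, where w' : Fin h → ZMod 2 has first r coordinates b and last h − r coordinates Rᵀ ·ᵥ b, and apply X^x Z^z to register s of Ψ₁. Then for every choice of outcomes (a, b, c, d) the resulting vector is a nonzero complex scalar multiple of the graph state |G⟩ on the registers (s, t'). -/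

import Mathlib

open Matrix

/-- The sign `(−1)^u` for `u : ZMod 2`. -/
noncomputable def sgn (u : ZMod 2) : ℂ := if u = 0 then 1 else -1

/-- The quadratic form `Q_G(s) = ∑_{i < j} G i j * s i * s j` of a graph. -/
def qform {n : ℕ} (G : Matrix (Fin n) (Fin n) (ZMod 2)) (s : Fin n → ZMod 2) : ZMod 2 :=
  ∑ i : Fin n, ∑ j : Fin n, if i < j then G i j * s i * s j else 0

/-- The graph state `|G⟩(s) = 2^(−n/2) · (−1)^(Q_G(s))`. -/
noncomputable def graphState {n : ℕ} (G : Matrix (Fin n) (Fin n) (ZMod 2))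
    (s : Fin n → ZMod 2) : ℂ :=
  (((Real.sqrt 2)⁻¹ ^ n : ℝ) : ℂ) * sgn (qform G s)

/-- The inner product `⟨z, s⟩ = ∑ i, z i * s i` in `ZMod 2`. -/
def inn {n : ℕ} (z s : Fin n → ZMod 2) : ZMod 2 := ∑ i, z i * s i

/-- The equivalence `Fin a ⊕ Fin (b - a) ≃ Fin b` induced by `finSumFinEquiv`, for `a ≤ b`. -/
def eqr {a b : ℕ} (hab : a ≤ b) : Fin a ⊕ Fin (b - a) ≃ Fin b :=
  finSumFinEquiv.trans (finCongr (Nat.add_sub_cancel' hab))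

/-- Concatenation of bit vectors along `finSumFinEquiv`. -/
def cat {h m : ℕ} (s : Fin h → ZMod 2) (t : Fin m → ZMod 2) : Fin (h + m) → ZMod 2 :=
  fun i => Sum.elim s t (finSumFinEquiv.symm i)

/-- The Bell functional with outcomes `(bB, cB)`: it sends the basis pair `(0, cB)` to `1`,
the basis pair `(1, cB + 1)` to `(−1)^{bB}`, and the other two basis pairs to `0`. -/
noncomputable def bellF (cB bB : ZMod 2) (α β : ZMod 2) : ℂ :=
  if β = α + cB then sgn (bB * α) else 0

lemma sgn_add' (u v : ZMod 2) : sgn (u + v) = sgn u * sgn v := by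
  have h : ∀ u v : ZMod 2, u + v = 0 ↔ (u = 0 ↔ v = 0) := by decide
  unfold sgn
  by_cases hu : u = 0 <;> by_cases hv : v = 0 <;> simp [h, hu, hv]

lemma sgn_zero' : sgn 0 = 1 := by simp [sgn]

lemma sgn_ne (u : ZMod 2) : sgn u ≠ 0 := by
  unfold sgn; split_ifs <;> simp

lemma sgn_sq (u : ZMod 2) : sgn u * sgn u = 1 := by
  unfold sgn; split_ifs <;> simp

lemma sgn_sum' {ι : Type*} (S : Finset ι) (f : ι → ZMod 2) :
    sgn (∑ i ∈ S, f i) = ∏ i ∈ S, sgn (f i) := by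
  classical
  induction S using Finset.induction_on with
  | empty => simp [sgn]
  | insert a S ha ih => rw [Finset.sum_insert ha, Finset.prod_insert ha, sgn_add', ih]

lemma sum_sgn_one (v : ZMod 2) : ∑ u : ZMod 2, sgn (v * u) = if v = 0 then 2 else 0 := by
  have h : ∀ v : ZMod 2, v = 0 ∨ v = 1 := by decide
  have h2 : ∀ f : ZMod 2 → ℂ, ∑ u : ZMod 2, f u = f 0 + f 1 := fun f => Fin.sum_univ_two f
  rw [h2]
  rcases h v with rfl | rfl <;> simp [sgn]
  norm_num

lemma sum_sgn {m : ℕ} (v : Fin m → ZMod 2) :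
    ∑ u : Fin m → ZMod 2, sgn (inn v u) = if v = 0 then 2 ^ m else 0 := by
  have h1 : ∑ u : Fin m → ZMod 2, sgn (inn v u) = ∏ i, ∑ a : ZMod 2, sgn (v i * a) := by
    rw [Finset.prod_univ_sum]
    simp [inn, sgn_sum']
  rw [h1]
  simp only [sum_sgn_one]
  split_ifs with hv
  · simp [hv]
  · obtain ⟨i, hi⟩ := Function.ne_iff.mp hv
    exact Finset.prod_eq_zero (Finset.mem_univ i) (by simpa using hi)

lemma inn_eq {n : ℕ} (z s : Fin n → ZMod 2) : inn z s = z ⬝ᵥ s := rfl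

lemma qform_cat {h m : ℕ} (GH : Matrix (Fin h) (Fin h) (ZMod 2))
    (GM : Matrix (Fin m) (Fin m) (ZMod 2)) (Γ : Matrix (Fin m) (Fin h) (ZMod 2))
    (s : Fin h → ZMod 2) (t : Fin m → ZMod 2) :
    qform ((Matrix.fromBlocks GH Γᵀ Γ GM).submatrix
        (⇑finSumFinEquiv.symm) (⇑finSumFinEquiv.symm)) (cat s t)
      = qform GH s + qform GM t + (Γ *ᵥ s) ⬝ᵥ t := by
  have h1 : ∀ (i : Fin m) (j : Fin h), ¬ (Fin.natAdd h i < Fin.castAdd m j) := by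
    intro i j; rw [Fin.lt_def]; simp; omega
  have h2 : ∀ (i : Fin m) (j : Fin h), (Fin.castAdd m j < Fin.natAdd h i) := by
    intro i j; rw [Fin.lt_def]; simp; omega
  have h3 : ∀ (i j : Fin m), (Fin.natAdd h i < Fin.natAdd h j) ↔ i < j := by
    intro i j; rw [Fin.lt_def, Fin.lt_def]; simp
  have h4 : ∀ (i j : Fin h), (Fin.castAdd m i < Fin.castAdd m j) ↔ i < j := by
    intro i j; rw [Fin.lt_def, Fin.lt_def]; simp
  have h5 : (Γ *ᵥ s) ⬝ᵥ t = ∑ j : Fin h, ∑ i : Fin m, Γ i j * s j * t i := by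
    rw [Finset.sum_comm]
    simp [dotProduct, mulVec, Finset.sum_mul]
  rw [h5]
  simp only [qform, cat, Fin.sum_univ_add, h1, h2, h3, h4, submatrix_apply,
    finSumFinEquiv_symm_apply_castAdd, finSumFinEquiv_symm_apply_natAdd, fromBlocks_apply₁₁,
    fromBlocks_apply₁₂, fromBlocks_apply₂₁, fromBlocks_apply₂₂, Sum.elim_inl, Sum.elim_inr,
    if_true, if_false, transpose_apply, Finset.sum_add_distrib, Finset.sum_const_zero]
  ring

lemma qform_add {n : ℕ} (G : Matrix (Fin n) (Fin n) (ZMod 2)) (hs : G.IsSymm)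
    (hd : ∀ i, G i i = 0) (s x : Fin n → ZMod 2) :
    qform G (s + x) = qform G s + qform G x + (G *ᵥ x) ⬝ᵥ s := by
  have h1 : (G *ᵥ x) ⬝ᵥ s = (∑ i, ∑ j, if i < j then G i j * s i * x j else 0)
      + ∑ i, ∑ j, if i < j then G i j * x i * s j else 0 := by
    rw [Finset.sum_comm (f := fun i j => if i < j then G i j * x i * s j else 0)]
    simp only [dotProduct, mulVec, Finset.sum_mul, ← Finset.sum_add_distrib]
    refine Finset.sum_congr rfl fun i _ => Finset.sum_congr rfl fun j _ => ?_
    rcases lt_trichotomy i j with h | h | h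
    · simp [h, h.not_gt]; ring
    · subst h; simp [hd]
    · simp [h, h.not_gt, hs.apply]
  rw [h1]
  simp only [qform, ← Finset.sum_add_distrib]
  refine Finset.sum_congr rfl fun i _ => Finset.sum_congr rfl fun j _ => ?_
  split_ifs
  · simp only [Pi.add_apply]; ring
  · simp

/-- the middle matrix of the decomposition -/
def midB {h m r : ℕ} (hrh : r ≤ h) (hrm : r ≤ m) (R : Matrix (Fin r) (Fin (h - r)) (ZMod 2)) :
    Matrix (Fin m) (Fin h) (ZMod 2) :=
  (Matrix.fromBlocks (1 : Matrix (Fin r) (Fin r) (ZMod 2)) R 0 0).submatrix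
          (⇑(eqr hrm).symm) (⇑(eqr hrh).symm)

lemma midB_inl {h m r : ℕ} (hrh : r ≤ h) (hrm : r ≤ m) (R : Matrix (Fin r) (Fin (h - r)) (ZMod 2))
    (v : Fin h → ZMod 2) (i : Fin r) :
    (midB hrh hrm R *ᵥ v) (eqr hrm (Sum.inl i)) = v (eqr hrh (Sum.inl i))
      + (R *ᵥ fun k => v (eqr hrh (Sum.inr k))) i := by
  simp only [midB, mulVec, dotProduct]
  rw [← (eqr hrh).sum_comp]
  simp [Fintype.sum_sum_type, one_apply]

lemma midB_inr {h m r : ℕ} (hrh : r ≤ h) (hrm : r ≤ m) (R : Matrix (Fin r) (Fin (h - r)) (ZMod 2))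
    (v : Fin h → ZMod 2) (k : Fin (m - r)) :
    (midB hrh hrm R *ᵥ v) (eqr hrm (Sum.inr k)) = 0 := by
  simp only [midB, mulVec, dotProduct]
  rw [← (eqr hrh).sum_comp]
  simp [Fintype.sum_sum_type]

lemma eqr_ext {a b : ℕ} (hab : a ≤ b) {v w : Fin b → ZMod 2}
    (h1 : ∀ i, v (eqr hab (Sum.inl i)) = w (eqr hab (Sum.inl i)))
    (h2 : ∀ i, v (eqr hab (Sum.inr i)) = w (eqr hab (Sum.inr i))) : v = w := by
  funext i
  obtain ⟨j, rfl⟩ := (eqr hab).surjective i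
  rcases j with j | j
  · exact h1 j
  · exact h2 j

/-- Generalized entanglement swapping: merging two copies of a graph state `|G⟩` by
Bell and Hadamard-basis measurements on the registers `t` and `s'` (after the phases,
Hadamards and linear relabelings described in the paper), followed by the Pauli
correction `X^x Z^z` on register `s`, produces `|G⟩` on the registers `(s, t')` up to a
nonzero scalar, for every choice of measurement outcomes `(a, b, c, d)`. -/
theorem stmt7 {h m r : ℕ} (hrh : r ≤ h) (hrm : r ≤ m)
    (GH : Matrix (Fin h) (Fin h) (ZMod 2)) (hGHs : GH.IsSymm) (hGHd : ∀ i, GH i i = 0)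
    (GM : Matrix (Fin m) (Fin m) (ZMod 2)) (hGMs : GM.IsSymm) (hGMd : ∀ i, GM i i = 0)
    (Γ : Matrix (Fin m) (Fin h) (ZMod 2))
    (U : Matrix (Fin h) (Fin h) (ZMod 2)) (hU : IsUnit U)
    (V : Matrix (Fin m) (Fin m) (ZMod 2)) (hV : IsUnit V)
    (R : Matrix (Fin r) (Fin (h - r)) (ZMod 2))
    (hΓ : Γ = V * ((Matrix.fromBlocks (1 : Matrix (Fin r) (Fin r) (ZMod 2)) R 0 0).submatrix
          (⇑(eqr hrm).symm) (⇑(eqr hrh).symm)) * U)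
    (G : Matrix (Fin (h + m)) (Fin (h + m)) (ZMod 2))
    (hG : G = (Matrix.fromBlocks GH Γᵀ Γ GM).submatrix
        (⇑finSumFinEquiv.symm) (⇑finSumFinEquiv.symm))
    (b c : Fin r → ZMod 2) (a : Fin (m - r) → ZMod 2) (d : Fin (h - r) → ZMod 2) :
    -- the vector `w` with first `r` coordinates `c + R ·ᵥ d` and last `h − r` coordinates `0`
    let w : Fin h → ZMod 2 :=
      fun i => Sum.elim (fun i0 => c i0 + R.mulVec d i0) (fun _ => 0) ((eqr hrh).symm i)
    -- the X-correction `x := U⁻¹ ·ᵥ w`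
    let x : Fin h → ZMod 2 := (U⁻¹).mulVec w
    -- the vector `w'` with first `r` coordinates `b` and last `h − r` coordinates `Rᵀ ·ᵥ b`
    let w' : Fin h → ZMod 2 := fun i => Sum.elim b (Rᵀ.mulVec b) ((eqr hrh).symm i)
    -- the Z-correction `z := Uᵀ ·ᵥ w' + G_H ·ᵥ x`
    let z : Fin h → ZMod 2 := Uᵀ.mulVec w' + GH.mulVec x
    -- `Ψ₁ s t'`: the vector on the surviving registers `(s, t')` obtained from the two
    -- copies `Ψ₀(s,t,s',t') = |G⟩(s ⧺ t) · |G⟩(s' ⧺ t')` by (i) the phases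
    -- `(−1)^{Q_{G_M}(t)}` and `(−1)^{Q_{G_H}(s')}`, (ii) a Hadamard on each qubit of `t`,
    -- (iii) the relabelings `|u⟩ ↦ |V⁻¹ ·ᵥ u⟩` on `t` and `|u⟩ ↦ |U ·ᵥ u⟩` on `s'`,
    -- (iv) Bell contractions with outcomes `(b i, c i)` on the pairs of first `r` qubits,
    -- (v) Hadamard-basis contractions with outcomes `a` on the last `m − r` qubits of `t`,
    -- (vi) computational-basis contractions with outcomes `d` on the last `h − r` qubits of `s'`
    let Ψ₁ : (Fin h → ZMod 2) → (Fin m → ZMod 2) → ℂ := fun s t' =>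
      ∑ t : Fin m → ZMod 2, ∑ s' : Fin h → ZMod 2,
        (∏ i : Fin r, bellF (c i) (b i) (t (eqr hrm (Sum.inl i))) (s' (eqr hrh (Sum.inl i)))) *
        (∏ k : Fin (m - r), sgn (a k * t (eqr hrm (Sum.inr k)))) *
        (∏ k : Fin (h - r), if s' (eqr hrh (Sum.inr k)) = d k then 1 else 0) *
        ((((Real.sqrt 2)⁻¹ ^ m : ℝ) : ℂ) *
          ∑ u : Fin m → ZMod 2,
            sgn (inn (V.mulVec t) u) * sgn (qform GM u) *
              sgn (qform GH ((U⁻¹).mulVec s')) *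
              (graphState G (cat s u) * graphState G (cat ((U⁻¹).mulVec s') t')))
    ∃ γ : ℂ, γ ≠ 0 ∧ ∀ (s : Fin h → ZMod 2) (t' : Fin m → ZMod 2),
      sgn (inn z (s + x)) * Ψ₁ (s + x) t' = γ * graphState G (cat s t') := by
  intro w x w' z Ψ₁
  set B := midB hrh hrm R with hB
  have hΓ' : Γ = V * B * U := hΓ
  have hUd : IsUnit U.det := (Matrix.isUnit_iff_isUnit_det U).mp hU
  have hUx : U *ᵥ x = w := by
    simp [x, mulVec_mulVec, Matrix.mul_nonsing_inv U hUd]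
  have char2 : ∀ v : ZMod 2, v + v = 0 := CharTwo.add_self_eq_zero
  set K : ℂ := (((Real.sqrt 2)⁻¹ ^ m : ℝ) : ℂ) with hK
  set L : ℂ := (((Real.sqrt 2)⁻¹ ^ (h + m) : ℝ) : ℂ) with hL
  -- the inner product `b · t₁`
  have hbt : ∀ v : Fin h → ZMod 2,
      ∑ i, b i * (B *ᵥ v) (eqr hrm (Sum.inl i)) = w' ⬝ᵥ v := by
    intro v
    have e1 : w' ⬝ᵥ v = b ⬝ᵥ (fun i => v (eqr hrh (Sum.inl i)))
        + (Rᵀ *ᵥ b) ⬝ᵥ (fun i => v (eqr hrh (Sum.inr i))) := by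
      simp only [dotProduct]
      rw [← (eqr hrh).sum_comp]
      simp [Fintype.sum_sum_type, w']
    rw [e1, mulVec_transpose, ← dotProduct_mulVec, ← dotProduct_add]
    simp only [dotProduct, hB, midB_inl, Pi.add_apply]
  -- evaluation of `Ψ₁`
  have key : ∀ s t', Ψ₁ s t' = K * L * L * 2 ^ m *
      sgn (qform GH s + qform GM t' + w' ⬝ᵥ (U *ᵥ s) + (Γ *ᵥ (s + x)) ⬝ᵥ t') := by
    intro s t'
    set t0 : Fin m → ZMod 2 := B *ᵥ (U *ᵥ s) with ht0
    set s0 : Fin h → ZMod 2 := fun i =>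
      Sum.elim (fun i => t0 (eqr hrm (Sum.inl i)) + c i) d ((eqr hrh).symm i) with hs0
    have hV0 : ∀ t, V *ᵥ t + Γ *ᵥ s = 0 ↔ t = t0 := by
      intro t
      have e : Γ *ᵥ s = V *ᵥ t0 := by
        rw [hΓ', ht0, mulVec_mulVec, mulVec_mulVec, Matrix.mul_assoc]
      rw [e, ← mulVec_add]
      constructor
      · intro h0
        have h1 : t + t0 = 0 := by
          apply Matrix.mulVec_injective_iff_isUnit.mpr hV
          simpa using h0
        funext i
        have h2 := congrFun h1 i
        exact CharTwo.add_eq_zero.mp h2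
      · rintro rfl
        have : t0 + t0 = 0 := by funext i; exact char2 _
        rw [this, mulVec_zero]
    have inner : ∀ t s' : _, (∑ u : Fin m → ZMod 2,
            sgn (inn (V.mulVec t) u) * sgn (qform GM u) *
              sgn (qform GH ((U⁻¹).mulVec s')) *
              (graphState G (cat s u) * graphState G (cat ((U⁻¹).mulVec s') t')))
        = (L * L * sgn (qform GH s + qform GM t' + (Γ *ᵥ (U⁻¹ *ᵥ s')) ⬝ᵥ t')) *
          (if t = t0 then 2 ^ m else 0) := by
      intro t s'
      have e := sum_sgn (V *ᵥ t + Γ *ᵥ s)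
      simp only [hV0] at e
      rw [← e, Finset.mul_sum]
      refine Finset.sum_congr rfl fun u _ => ?_
      rw [hG]
      simp only [graphState, qform_cat, inn_eq, add_dotProduct, sgn_add', ← hL]
      have q1 := sgn_sq (qform GM u)
      have q2 := sgn_sq (qform GH (U⁻¹ *ᵥ s'))
      generalize sgn (qform GM u) = p1 at *
      generalize sgn (qform GH (U⁻¹ *ᵥ s')) = p2 at *
      linear_combination (L * L * sgn (V *ᵥ t ⬝ᵥ u) * sgn (qform GH s) * sgn (Γ *ᵥ s ⬝ᵥ u)
        * sgn (qform GM t') * sgn (Γ *ᵥ (U⁻¹ *ᵥ s') ⬝ᵥ t')) * (p2 * p2 * q1 + q2)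
    have hx1 : Γ *ᵥ (U⁻¹ *ᵥ s0) = Γ *ᵥ (s + x) := by
      have e1 : Γ *ᵥ (U⁻¹ *ᵥ s0) = V *ᵥ (B *ᵥ s0) := by
        rw [hΓ', mulVec_mulVec, mulVec_mulVec, Matrix.mul_assoc (V * B),
          Matrix.mul_nonsing_inv U hUd, Matrix.mul_one]
      have e2 : Γ *ᵥ (s + x) = V *ᵥ (B *ᵥ (U *ᵥ (s + x))) := by
        rw [hΓ', mulVec_mulVec, mulVec_mulVec, Matrix.mul_assoc]
      rw [e1, e2, mulVec_add U, mulVec_add B, ← ht0, hUx]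
      congr 1
      apply eqr_ext hrm
      · intro i
        have e3 : (fun k => w (eqr hrh (Sum.inr k))) = 0 := by funext k; simp [w]
        rw [Pi.add_apply, midB_inl, midB_inl, e3]
        simp [hs0, w, add_assoc]
      · intro i
        simp only [Pi.add_apply, hB, ht0, midB_inr, add_zero]
    simp only [Ψ₁, inner]
    rw [Finset.sum_eq_single t0 ?_ (by simp), Finset.sum_eq_single s0 ?_ (by simp)]
    · have p1 : ∏ i : Fin r, bellF (c i) (b i) (t0 (eqr hrm (Sum.inl i)))
          (s0 (eqr hrh (Sum.inl i))) = sgn (w' ⬝ᵥ (U *ᵥ s)) := by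
        rw [← hbt, sgn_sum']
        refine Finset.prod_congr rfl fun i _ => ?_
        simp [bellF, hs0, ht0]
      have p2 : ∏ k : Fin (m - r), sgn (a k * t0 (eqr hrm (Sum.inr k))) = 1 := by
        refine Finset.prod_eq_one fun k _ => ?_
        rw [ht0, midB_inr, mul_zero, sgn_zero']
      have p3 : (∏ k : Fin (h - r), if s0 (eqr hrh (Sum.inr k)) = d k then (1 : ℂ) else 0)
          = 1 := by
        refine Finset.prod_eq_one fun k _ => ?_
        simp [hs0]
      rw [p1, p2, p3, hx1]
      simp only [sgn_add', if_true]
      ring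
    · intro s' _ hs'
      by_contra hne
      apply hs'
      have hA := left_ne_zero_of_mul hne
      have h3 := right_ne_zero_of_mul hA
      have h1 := left_ne_zero_of_mul (left_ne_zero_of_mul hA)
      rw [Finset.prod_ne_zero_iff] at h1 h3
      apply eqr_ext hrh
      · intro i
        have := h1 i (Finset.mem_univ _)
        simp only [bellF] at this
        simp [hs0]
        by_contra hc
        simp [hc] at this
      · intro i
        have := h3 i (Finset.mem_univ _)
        simp [hs0]
        by_contra hc
        simp [hc] at this
    · intro t _ ht
      simp [ht]
  refine ⟨K * L * 2 ^ m * sgn (qform GH x + (GH *ᵥ x) ⬝ᵥ x), ?_, ?_⟩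
  · have hs2 : (Real.sqrt 2)⁻¹ ≠ 0 := by positivity
    refine mul_ne_zero (mul_ne_zero (mul_ne_zero ?_ ?_) (pow_ne_zero _ two_ne_zero)) (sgn_ne _)
    · rw [hK]; exact_mod_cast pow_ne_zero _ hs2
    · rw [hL]; exact_mod_cast pow_ne_zero _ hs2
  · intro s t'
    have hxx : s + x + x = s := by
      funext i; simp only [Pi.add_apply]; rw [add_assoc, char2, add_zero]
    rw [key, hxx, hG]
    simp only [graphState, qform_cat, ← hL]
    have hz : inn z (s + x) = w' ⬝ᵥ (U *ᵥ (s + x)) + ((GH *ᵥ x) ⬝ᵥ s + (GH *ᵥ x) ⬝ᵥ x) := by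
      rw [inn_eq, ← dotProduct_add]
      simp only [z, add_dotProduct]
      rw [mulVec_transpose, ← dotProduct_mulVec]
    rw [hz, qform_add GH hGHs hGHd]
    simp only [sgn_add']
    have q1 := sgn_sq (w' ⬝ᵥ (U *ᵥ (s + x)))
    have q2 := sgn_sq ((GH *ᵥ x) ⬝ᵥ s)
    generalize sgn (w' ⬝ᵥ (U *ᵥ (s + x))) = p1 at *
    generalize sgn ((GH *ᵥ x) ⬝ᵥ s) = p2 at *
    linear_combination (K * L * L * 2 ^ m * sgn ((GH *ᵥ x) ⬝ᵥ x) * sgn (qform GH s)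
      * sgn (qform GH x) * sgn (qform GM t') * sgn ((Γ *ᵥ s) ⬝ᵥ t')) * (p2 * p2 * q1 + q2)
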